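/- Let $G$ be a graph and $I = I(G)$ its edge ideal in $S = K[x_1,\dots,x_n]$. Then the toric ring $R_G$ is a normal domain if and only if at most one connected component of $G$ is non-bipartite and that component satisfies the odd cycle condition (any two vertex-disjoint induced odd cycles are joined by an edge). -/

import Mathlib

open MvPolynomial

set_option synthInstance.maxHeartbeats 1000000

noncomputable section

/-- The ambient polynomial ring `K[x_i : i ∈ V][t]`, with the variable `none` playing
the role of `t`. -/
abbrev Amb (K V : Type*) [CommSemiring K] := MvPolynomial (Option V) K

variable (K : Type*) [Field K] {V : Type*} [DecidableEq V]

/-- The generator `t`. -/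
def tGen : Amb K V := X none

/-- The generator `x_i t`. -/
def vGen (i : V) : Amb K V := X (some i) * X none

/-- The generator `x_i x_j t`. -/
def eGen (i j : V) : Amb K V := X (some i) * X (some j) * X none

variable (G : SimpleGraph V)

/-- The toric ring `R_G = K[t, {x_i t}, {x_i x_j t : {i,j} ∈ E(G)}]` of the graph `G`. -/
def RG : Subalgebra K (Amb K V) :=
  Algebra.adjoin K
    ({tGen K} ∪ Set.range (vGen K (V := V)) ∪ {p | ∃ i j, G.Adj i j ∧ p = eGen K i j})

/-- The faces of the one-dimensional simplicial complex attached to `G`. -/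
def IsFace (F : Finset V) : Prop :=
  F = ∅ ∨ (∃ i, F = {i}) ∨ ∃ i j, G.Adj i j ∧ F = {i, j}

/-- The monomial `x_F t`. -/
def faceMon (F : Finset V) : Amb K V := (∏ i ∈ F, X (some i)) * X none

/-- The ideal `P_0 = (t, x_1 t, …, x_n t)` of `R_G`. -/
def P0 : Ideal (RG K G) :=
  Ideal.span {u : RG K G | ((u : Amb K V) = tGen K) ∨ ∃ i, (u : Amb K V) = vGen K i}

/-- The principal ideal `(t)` of `R_G`. -/
def tIdeal : Ideal (RG K G) := Ideal.span {u : RG K G | (u : Amb K V) = tGen K}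

/-- The ideal `P_C` generated by the monomials `x_F t` for faces `F ⊆ C`. -/
def PC (C : Finset V) : Ideal (RG K G) :=
  Ideal.span {u : RG K G | ∃ F : Finset V, IsFace G F ∧ F ⊆ C ∧ (u : Amb K V) = faceMon K F}

/-- The ideal `Q_i` generated by the monomials `x_F t` for faces `F ∋ i`. -/
def Qi (i : V) : Ideal (RG K G) :=
  Ideal.span {u : RG K G | ∃ F : Finset V, IsFace G F ∧ i ∈ F ∧ (u : Amb K V) = faceMon K F}

/-- A vertex cover of `G`. -/
def IsVertexCover (C : Finset V) : Prop := ∀ ⦃i j⦄, G.Adj i j → i ∈ C ∨ j ∈ C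

/-- A minimal vertex cover of `G`. -/
def IsMinVertexCover (C : Finset V) : Prop :=
  IsVertexCover G C ∧ ∀ C' ⊆ C, IsVertexCover G C' → C' = C

/-- An induced odd cycle of `G`, given by an injective cyclic enumeration of its
vertices such that adjacency holds exactly between consecutive vertices. -/
def IsInducedOddCycle {V : Type*} (G : SimpleGraph V) (m : ℕ) (c : ZMod m → V) : Prop :=
  3 ≤ m ∧ Odd m ∧ Function.Injective c ∧
    ∀ p q : ZMod m, G.Adj (c p) (c q) ↔ (q = p + 1 ∨ p = q + 1)

/-- The monomial `x^a t^b` of the ambient ring. -/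
def monom [Fintype V] (a : V → ℕ) (b : ℕ) : Amb K V :=
  (∏ i, X (some i) ^ a i) * X none ^ b

/-- An element of `R_G` which is a monomial. -/
def IsMonomialElt [Fintype V] (u : RG K G) : Prop :=
  ∃ (a : V → ℕ) (b : ℕ), (u : Amb K V) = monom K a b

/-- A monomial ideal of `R_G`. -/
def IsMonomialIdeal [Fintype V] (I : Ideal (RG K G)) : Prop :=
  ∃ S : Set (RG K G), (∀ u ∈ S, IsMonomialElt K G u) ∧ I = Ideal.span S

/-- A height one ideal of the domain `R_G`: a nonzero prime all of whose properly
contained primes are zero. -/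
def HeightOne (I : Ideal (RG K G)) : Prop :=
  I.IsPrime ∧ I ≠ ⊥ ∧ ∀ J : Ideal (RG K G), J.IsPrime → J < I → J = ⊥

/-- The ideal contains the element `t`. -/
def ContainsT (I : Ideal (RG K G)) : Prop := ∃ u ∈ I, (u : Amb K V) = tGen K

/-- The canonical ideal of `R_G` (for `R_G` normal): the intersection of all height one
monomial prime ideals. -/
def canonicalIdeal [Fintype V] : Ideal (RG K G) :=
  sInf {P : Ideal (RG K G) | HeightOne K G P ∧ IsMonomialIdeal K G P}

/-- `R_G` is Gorenstein: the canonical ideal (= canonical module) is isomorphic to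
`R_G` as an `R_G`-module, equivalently it is a principal ideal, i.e. the canonical
class vanishes. -/
def IsGorensteinToric [Fintype V] : Prop :=
  (canonicalIdeal K G).IsPrincipal

/-- A graph that is not bipartite contains an induced odd cycle. -/
theorem exists_isInducedOddCycle {α : Type*} (H : SimpleGraph α) (h : ¬ H.Colorable 2) :
    ∃ m c, IsInducedOddCycle H m c := by
  classical
  rw [SimpleGraph.two_colorable_iff_forall_loop_even] at h
  push Not at h
  obtain ⟨u, w, hw⟩ := h
  have hex : ∃ m, Odd m ∧ ∃ c : ℕ → α, c m = c 0 ∧ ∀ i < m, H.Adj (c i) (c (i + 1)) :=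
    ⟨w.length, by simpa using hw, w.getVert, by simp, fun i hi => w.adj_getVert_succ hi⟩
  have hspec := Nat.find_spec hex
  have hmin := fun k => Nat.find_min hex (m := k)
  generalize Nat.find hex = m at hspec hmin
  obtain ⟨hodd, c, hc0, hadj⟩ := hspec
  have hne : ∀ i j, i < j → j < m → c i ≠ c j := by
    intro i j hij hj he
    rcases Nat.even_or_odd (j - i) with hev | ho
    · refine hmin (m - (j - i)) (by omega) ⟨?_, fun k => if k ≤ i then c k else c (k + (j - i)),
        ?_, ?_⟩
      · exact Nat.Odd.sub_even (by omega) hodd hev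
      · have h1 : ¬ (m - (j - i) ≤ i) := by omega
        simp only [h1, if_false, Nat.zero_le, if_true]
        rw [← hc0]; congr 1; omega
      · intro k hk
        rcases lt_trichotomy k i with h1 | h1 | h1
        · have h2 : k + 1 ≤ i := h1
          simp only [h1.le, h2, if_true]
          exact hadj k (by omega)
        · subst h1
          have h2 : ¬ (k + 1 ≤ k) := by omega
          simp only [le_refl, h2, if_true, if_false]
          rw [he, show k + 1 + (j - k) = j + 1 by omega]
          exact hadj j hj
        · have h2 : ¬ (k + 1 ≤ i) := by omega
          have h3 : ¬ (k ≤ i) := by omega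
          simp only [h2, h3, if_false]
          rw [show k + 1 + (j - i) = k + (j - i) + 1 by omega]
          exact hadj _ (by omega)
    · refine hmin (j - i) (by omega) ⟨ho, fun k => c (i + k), ?_, fun k hk => hadj _ (by omega)⟩
      simp only [add_zero]
      rw [he]; congr 1; omega
  have hch : ∀ i j, i < j → j < m → H.Adj (c i) (c j) → j - i = 1 ∨ j - i = m - 1 := by
    intro i j hij hj he
    by_contra hcon
    push Not at hcon
    rcases Nat.even_or_odd (j - i) with hev | ho
    · refine hmin (j - i + 1) (by omega) ⟨hev.add_one,
        fun k => if k ≤ j - i then c (i + k) else c i, ?_, ?_⟩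
      · simp
      · intro k hk
        rcases Nat.lt_or_ge k (j - i) with h1 | h1
        · have h2 : k + 1 ≤ j - i := h1
          simp only [h1.le, h2, if_true]
          exact hadj _ (by omega)
        · have h2 : ¬ (k + 1 ≤ j - i) := by omega
          have h3 : k = j - i := by omega
          simp only [h2, if_false, h3.le, if_true]
          rw [show i + k = j by omega]
          exact he.symm
    · refine hmin (m - (j - i) + 1) (by omega)
        ⟨?_, fun k => if k ≤ i then c k else c (k + (j - i) - 1), ?_, ?_⟩
      · exact (Nat.Odd.sub_odd hodd ho).add_one
      · have h1 : ¬ (m - (j - i) + 1 ≤ i) := by omega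
        simp only [h1, if_false, Nat.zero_le, if_true]
        rw [← hc0]; congr 1; omega
      · intro k hk
        rcases lt_trichotomy k i with h1 | h1 | h1
        · have h2 : k + 1 ≤ i := h1
          simp only [h1.le, h2, if_true]
          exact hadj k (by omega)
        · subst h1
          have h2 : ¬ (k + 1 ≤ k) := by omega
          simp only [le_refl, h2, if_true, if_false]
          rw [show k + 1 + (j - k) - 1 = j by omega]
          exact he
        · have h2 : ¬ (k + 1 ≤ i) := by omega
          have h3 : ¬ (k ≤ i) := by omega
          simp only [h2, h3, if_false]
          rw [show k + 1 + (j - i) - 1 = k + (j - i) - 1 + 1 by omega]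
          exact hadj _ (by omega)
  have hm3 : 3 ≤ m := by
    by_contra hlt
    have h1 : m = 1 := by
      obtain ⟨k, hk⟩ := hodd
      omega
    subst h1
    have := hadj 0 (by omega)
    rw [zero_add, hc0] at this
    exact H.loopless.irrefl _ this
  have : NeZero m := ⟨by omega⟩
  have hsucc : ∀ p : ZMod m, H.Adj (c p.val) (c (p + 1).val) := by
    intro p
    have hp := p.val_lt
    have h1 : (p + 1).val = (p.val + 1) % m := by
      rw [ZMod.val_add, ZMod.val_one'' (by omega)]
    rcases Nat.lt_or_ge (p.val + 1) m with h2 | h2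
    · rw [h1, Nat.mod_eq_of_lt h2]
      exact hadj _ hp
    · have h3 : p.val + 1 = m := by omega
      have := hadj _ hp
      rw [h3, hc0] at this
      rwa [h1, h3, Nat.mod_self]
  have hlt : ∀ p q : ZMod m, p.val < q.val → H.Adj (c p.val) (c q.val) →
      q = p + 1 ∨ p = q + 1 := by
    intro p q hpq had
    have hq := q.val_lt
    rcases hch _ _ hpq hq had with h1 | h1
    · left
      rw [← ZMod.natCast_zmod_val q, ← ZMod.natCast_zmod_val p, ← Nat.cast_one, ← Nat.cast_add]
      congr 1; omega
    · right
      have h2 : q.val + 1 = m := by omega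
      have h3 : p.val = 0 := by omega
      rw [← ZMod.natCast_zmod_val q, ← ZMod.natCast_zmod_val p, h3, ← Nat.cast_one,
        ← Nat.cast_add, h2]
      simp
  refine ⟨m, fun p => c p.val, hm3, hodd, ?_, ?_⟩
  · intro p q hpq
    apply ZMod.val_injective m
    rcases lt_trichotomy p.val q.val with h1 | h1 | h1
    · exact absurd hpq (hne _ _ h1 q.val_lt)
    · exact h1
    · exact absurd hpq.symm (hne _ _ h1 p.val_lt)
  · intro p q
    constructor
    · intro had
      rcases lt_trichotomy p.val q.val with h1 | h1 | h1
      · exact hlt p q h1 had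
      · exact absurd (congrArg c h1) had.ne
      · exact (hlt q p h1 had.symm).symm
    · rintro (rfl | rfl)
      · exact hsucc p
      · exact (hsucc q).symm

/-- A set of vertices inducing a non-bipartite subgraph contains an induced odd cycle. -/
theorem exists_isInducedOddCycle_mem {α : Type*} (H : SimpleGraph α) (s : Set α)
    (h : ¬ (H.induce s).Colorable 2) : ∃ m c, IsInducedOddCycle H m c ∧ ∀ p, c p ∈ s := by
  obtain ⟨m, c, h3, ho, hi, ha⟩ := exists_isInducedOddCycle _ h
  exact ⟨m, fun p => c p, ⟨h3, ho, Subtype.val_injective.comp hi, ha⟩, fun p => (c p).2⟩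

/-- A consequence of Tutte's theorem: a graph on an even number of vertices in which
independent sets expand and in which no two non-bipartite vertex sets are separated has a
perfect matching. -/
theorem exists_isPerfectMatching_of_expansion {α : Type*} [Fintype α] (H : SimpleGraph α)
    (heven : Even (Fintype.card α))
    (hexp : ∀ T N : Set α, (∀ x ∈ T, ∀ y ∈ T, ¬ H.Adj x y) →
      (∀ x ∈ T, ∀ y, H.Adj x y → y ∈ N) → T.ncard ≤ N.ncard)
    (hsep : ∀ A B : Set α, Disjoint A B → (∀ x ∈ A, ∀ y ∈ B, ¬ H.Adj x y) →
      (H.induce A).Colorable 2 ∨ (H.induce B).Colorable 2) :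
    ∃ M : H.Subgraph, M.IsPerfectMatching := by
  classical
  rw [SimpleGraph.tutte]
  intro U hU
  unfold SimpleGraph.IsTutteViolator at hU
  set D := ((⊤ : H.Subgraph).deleteVerts U).coe with hD
  have hDadj : ∀ x y, D.Adj x y ↔ H.Adj x.1 y.1 := by
    intro x y
    have hx := x.2.2
    have hy := y.2.2
    simp [hD, hx, hy]
  have hpar := SimpleGraph.odd_ncard_oddComponents D
  have hcard : Nat.card ((⊤ : H.Subgraph).deleteVerts U).verts + U.ncard = Fintype.card α := by
    rw [Nat.card_coe_set_eq, SimpleGraph.Subgraph.deleteVerts_verts,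
      SimpleGraph.Subgraph.verts_top, ← Set.compl_eq_univ_sdiff, add_comm, Set.ncard_add_ncard_compl,
      Nat.card_eq_fintype_card]
  have hU2 : U.ncard + 2 ≤ D.oddComponents.ncard := by
    rcases Nat.lt_or_ge (U.ncard + 1) D.oddComponents.ncard with h1 | h1
    · exact h1
    · have h2 : D.oddComponents.ncard = U.ncard + 1 := by omega
      rw [h2] at hpar
      obtain ⟨k, hk⟩ := heven
      rw [Nat.odd_iff, Nat.odd_iff] at hpar
      omega
  let S : D.ConnectedComponent → Set α := fun C => Subtype.val '' C.supp
  have hS : ∀ C x, x ∈ S C ↔ ∃ h, D.connectedComponentMk ⟨x, h⟩ = C := by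
    intro C x
    simp [S, SimpleGraph.ConnectedComponent.mem_supp_iff]
  have hSU : ∀ C x, x ∈ S C → x ∉ U := by
    intro C x hx
    obtain ⟨h, -⟩ := (hS C x).1 hx
    exact h.2
  have hSclosed : ∀ C x y, x ∈ S C → H.Adj x y → y ∉ U → y ∈ S C := by
    intro C x y hx hxy hy
    obtain ⟨h, rfl⟩ := (hS C x).1 hx
    rw [hS]
    refine ⟨⟨trivial, hy⟩, ?_⟩
    apply SimpleGraph.ConnectedComponent.connectedComponentMk_eq_of_adj
    rw [hDadj]
    exact hxy.symm
  have hSuniq : ∀ C C' x, x ∈ S C → x ∈ S C' → C = C' := by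
    intro C C' x h1 h2
    obtain ⟨h, rfl⟩ := (hS C x).1 h1
    obtain ⟨h', rfl⟩ := (hS C' x).1 h2
    rfl
  have hSodd : ∀ C ∈ D.oddComponents, Odd (S C).ncard := by
    intro C hC
    rw [Set.ncard_image_of_injective _ Subtype.val_injective]
    exact hC
  let B : Finset D.ConnectedComponent :=
    {C | C ∈ D.oddComponents ∧ (H.induce (S C)).Colorable 2}
  have hB : U.ncard + 1 ≤ B.card := by
    let O : Finset D.ConnectedComponent := {C | C ∈ D.oddComponents}
    have hO : D.oddComponents.ncard = O.card := by
      rw [Set.ncard_eq_toFinset_card']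
      congr 1
      ext C
      simp [O]
    have h1 : (O \ B).card ≤ 1 := by
      rw [Finset.card_le_one]
      intro C hC C' hC'
      by_contra hne
      simp only [O, B, Finset.mem_sdiff, Finset.mem_filter, Finset.mem_univ, true_and,
        not_and] at hC hC'
      rcases hsep (S C) (S C') (Set.disjoint_left.2 fun x h1 h2 => hne (hSuniq _ _ _ h1 h2))
        (fun x hx y hy hxy => hne (hSuniq _ _ y (hSclosed _ _ _ hx hxy (hSU _ _ hy)) hy)) with h | h
      · exact hC.2 hC.1 h
      · exact hC'.2 hC'.1 h
    have h2 := Finset.le_card_sdiff B O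
    omega
  have hcol : ∀ C ∈ B, ∃ P Q : Finset α, (∀ x ∈ P, x ∈ S C) ∧ (∀ x ∈ P, ∀ y ∈ P, ¬ H.Adj x y) ∧
      (∀ x ∈ P, ∀ y, H.Adj x y → y ∉ U → y ∈ Q) ∧ Q.card + 1 ≤ P.card := by
    intro C hC
    simp only [B, Finset.mem_filter, Finset.mem_univ, true_and] at hC
    obtain ⟨hCo, ⟨f⟩⟩ := hC
    let P : Fin 2 → Finset α := fun k => {x | ∃ h : x ∈ S C, f ⟨x, h⟩ = k}
    have hP : ∀ k x, x ∈ P k ↔ ∃ h : x ∈ S C, f ⟨x, h⟩ = k := by simp [P]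
    have hind : ∀ k, ∀ x ∈ P k, ∀ y ∈ P k, ¬ H.Adj x y := by
      intro k x hx y hy hxy
      obtain ⟨hx1, hx2⟩ := (hP _ _).1 hx
      obtain ⟨hy1, hy2⟩ := (hP _ _).1 hy
      exact f.valid (v := ⟨x, hx1⟩) (w := ⟨y, hy1⟩) hxy (hx2.trans hy2.symm)
    have hnb : ∀ k l, k ≠ l → ∀ x ∈ P k, ∀ y, H.Adj x y → y ∉ U → y ∈ P l := by
      intro k l hkl x hx y hxy hy
      obtain ⟨hx1, hx2⟩ := (hP _ _).1 hx
      have hy1 := hSclosed _ _ _ hx1 hxy hy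
      have := f.valid (v := ⟨x, hx1⟩) (w := ⟨y, hy1⟩) hxy
      refine (hP _ _).2 ⟨hy1, ?_⟩
      omega
    have hsum : (P 0).card + (P 1).card = (S C).ncard := by
      rw [← Finset.card_union_of_disjoint, Set.ncard_eq_toFinset_card']
      · congr 1
        ext x
        simp only [Finset.mem_union, hP, Set.mem_toFinset]
        constructor
        · rintro (⟨h, -⟩ | ⟨h, -⟩) <;> exact h
        · intro h
          have : f ⟨x, h⟩ = 0 ∨ f ⟨x, h⟩ = 1 := by omega
          exact this.imp (fun e => ⟨h, e⟩) (fun e => ⟨h, e⟩)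
      · rw [Finset.disjoint_left]
        intro x h0 h1
        obtain ⟨_, h0⟩ := (hP _ _).1 h0
        obtain ⟨_, h1⟩ := (hP _ _).1 h1
        simp [h0] at h1
    obtain ⟨k, hk⟩ := hSodd C hCo
    have hsub : ∀ l, ∀ x ∈ P l, x ∈ S C := fun l x hx => ((hP _ _).1 hx).1
    rcases Nat.lt_or_ge (P 0).card (P 1).card with h1 | h1
    · exact ⟨P 1, P 0, hsub 1, hind 1, hnb 1 0 (by decide), h1⟩
    · exact ⟨P 0, P 1, hsub 0, hind 0, hnb 0 1 (by decide), by omega⟩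
  choose! P Q hPS hPind hPnb hPQ using hcol
  have hle := hexp (↑(B.biUnion P)) (U ∪ ↑(B.biUnion Q)) ?_ ?_
  · rw [Set.ncard_coe_finset, Finset.card_biUnion] at hle
    · have h1 := Set.ncard_union_le U (↑(B.biUnion Q))
      rw [Set.ncard_coe_finset] at h1
      have h2 : (B.biUnion Q).card ≤ ∑ C ∈ B, (Q C).card := Finset.card_biUnion_le
      have h3 : ∑ C ∈ B, ((Q C).card + 1) ≤ ∑ C ∈ B, (P C).card := Finset.sum_le_sum hPQ
      rw [Finset.sum_add_distrib, Finset.sum_const, smul_eq_mul, mul_one] at h3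
      omega
    · intro C hC C' hC' hne
      refine Finset.disjoint_left.2 fun x hx hx' => ?_
      exact hne (hSuniq _ _ x (hPS _ hC x hx) (hPS _ hC' x hx'))
  · intro x hx y hy hxy
    simp only [Finset.coe_biUnion, Set.mem_iUnion, Finset.mem_coe] at hx hy
    obtain ⟨C, hC, hx⟩ := hx
    obtain ⟨C', hC', hy⟩ := hy
    have h1 := hPS _ hC' y hy
    have : C = C' := hSuniq _ _ y (hSclosed _ _ _ (hPS _ hC x hx) hxy (hSU _ _ h1)) h1
    subst this
    exact hPind _ hC _ hx _ hy hxy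
  · intro x hx y hxy
    simp only [Finset.coe_biUnion, Set.mem_iUnion, Finset.mem_coe] at hx
    obtain ⟨C, hC, hx⟩ := hx
    by_cases hy : y ∈ U
    · exact Or.inl hy
    · refine Or.inr ?_
      simp only [Finset.coe_biUnion, Set.mem_iUnion, Finset.mem_coe]
      exact ⟨C, hC, hPnb _ hC x hx y hxy hy⟩

/-- Adjacency in the cone over `G` with a loop at the apex `none`. -/
def coneAdj {V : Type*} (G : SimpleGraph V) : Option V → Option V → Prop
  | some i, some j => G.Adj i j
  | _, _ => True

theorem coneAdj_symm {V : Type*} {G : SimpleGraph V} :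
    ∀ {o o' : Option V}, coneAdj G o o' → coneAdj G o' o
  | some _, some _, h => SimpleGraph.Adj.symm h
  | some _, none, _ => trivial
  | none, some _, _ => trivial
  | none, none, _ => trivial

/-- The graph obtained from the looped cone over `G` by replacing each vertex by the
corresponding fibre of `π`. -/
def blowup {V α : Type*} (G : SimpleGraph V) (π : α → Option V) : SimpleGraph α where
  Adj x y := x ≠ y ∧ coneAdj G (π x) (π y)
  symm := ⟨fun _ _ h => ⟨h.1.symm, coneAdj_symm h.2⟩⟩
  loopless := ⟨fun _ h => h.1 rfl⟩

theorem blowup_adj_of_eq_none {V α : Type*} (G : SimpleGraph V) {π : α → Option V} {x y : α}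
    (hne : x ≠ y) (hx : π x = none) : (blowup G π).Adj x y :=
  ⟨hne, by rw [hx]; trivial⟩

theorem blowup_adj_iff {V α : Type*} (G : SimpleGraph V) {π : α → Option V} {x y : α} {i j : V}
    (hx : π x = some i) (hy : π y = some j) : (blowup G π).Adj x y ↔ G.Adj i j := by
  constructor
  · rintro ⟨-, h⟩
    rwa [hx, hy] at h
  · intro h
    refine ⟨?_, by rw [hx, hy]; exact h⟩
    rintro rfl
    rw [hx] at hy
    exact h.ne (Option.some_injective _ hy)

/-- The odd cycle condition, for arbitrary pairs of induced odd cycles. -/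
def OddCycleCondition {V : Type*} (G : SimpleGraph V) : Prop :=
  ∀ (m₁ : ℕ) (c₁ : ZMod m₁ → V) (m₂ : ℕ) (c₂ : ZMod m₂ → V),
    IsInducedOddCycle G m₁ c₁ → IsInducedOddCycle G m₂ c₂ →
      (∃ p q, c₁ p = c₂ q) ∨ ∃ p q, G.Adj (c₁ p) (c₂ q)

theorem blowup_expansion {V α : Type*} [Fintype α] (G : SimpleGraph V) (π : α → Option V)
    (heven : Even (Fintype.card α))
    (hcone : ∀ w : Option V → ℕ, w none = 0 → (∀ i, w (some i) ≤ 2) →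
      (∀ i j, G.Adj i j → w (some i) + w (some j) ≤ 2) → ∑ x, w (π x) ≤ Fintype.card α)
    (T N : Set α) (hT : ∀ x ∈ T, ∀ y ∈ T, ¬ (blowup G π).Adj x y)
    (hN : ∀ x ∈ T, ∀ y, (blowup G π).Adj x y → y ∈ N) : T.ncard ≤ N.ncard := by
  classical
  rcases T.eq_empty_or_nonempty with rfl | hne
  · simp
  by_cases hnone : ∃ x ∈ T, π x = none
  · obtain ⟨x, hx, hπ⟩ := hnone
    have h1 : T.ncard ≤ 1 := by
      rw [Set.ncard_le_one]
      have key : ∀ y ∈ T, x = y := by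
        intro y hy
        by_contra h
        exact hT x hx y hy (blowup_adj_of_eq_none G h hπ)
      intro y hy z hz
      rw [← key y hy, ← key z hz]
    have h2 : 1 < Fintype.card α := by
      have : 0 < Fintype.card α := Fintype.card_pos_iff.2 ⟨x⟩
      obtain ⟨k, hk⟩ := heven
      omega
    obtain ⟨y, hy⟩ := Fintype.exists_ne_of_one_lt_card h2 x
    have h3 : 0 < N.ncard := by
      rw [Set.ncard_pos]
      exact ⟨y, hN x hx y (blowup_adj_of_eq_none G hy.symm hπ)⟩
    omega
  · push Not at hnone
    let w : Option V → ℕ := fun o => o.elim 0 fun i =>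
      if ∃ x ∈ T, π x = some i then 2
      else if ∃ x ∈ T, ∃ k, π x = some k ∧ G.Adj k i then 0 else 1
    have hw : ∀ i, w (some i) = if ∃ x ∈ T, π x = some i then 2
      else if ∃ x ∈ T, ∃ k, π x = some k ∧ G.Adj k i then 0 else 1 := fun _ => rfl
    have hw0 : ∀ i j, G.Adj i j → (∃ x ∈ T, π x = some i) → w (some j) = 0 := by
      rintro i j hij ⟨x, hx, hxi⟩
      have h1 : ¬ ∃ y ∈ T, π y = some j := by
        rintro ⟨y, hy, hyj⟩
        exact hT x hx y hy ((blowup_adj_iff G hxi hyj).2 hij)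
      rw [hw, if_neg h1, if_pos ⟨x, hx, i, hxi, hij⟩]
    have hw2 : ∀ i, w (some i) ≤ 2 := by
      intro i
      rw [hw]
      split_ifs <;> omega
    have hw1 : ∀ i, (¬ ∃ x ∈ T, π x = some i) → w (some i) ≤ 1 := by
      intro i hi
      rw [hw, if_neg hi]
      split_ifs <;> omega
    have hsum := hcone w rfl hw2 (by
      intro i j hij
      by_cases hi : ∃ x ∈ T, π x = some i
      · have := hw0 i j hij hi
        have := hw2 i
        omega
      by_cases hj : ∃ x ∈ T, π x = some j
      · have := hw0 j i hij.symm hj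
        have := hw2 j
        omega
      have := hw1 i hi
      have := hw1 j hj
      omega)
    have hpt : ∀ x, 1 + (if x ∈ T then 1 else 0) ≤ w (π x) + (if x ∈ N then 1 else 0) := by
      intro x
      rcases hπ : π x with _ | i
      · have h1 : x ∉ T := fun h => hnone x h hπ
        have h2 : x ∈ N := by
          obtain ⟨y, hy⟩ := hne
          have hxy : x ≠ y := fun h => h1 (h ▸ hy)
          exact hN y hy x (blowup_adj_of_eq_none G hxy hπ).symm
        simp [h1, h2]
      · rw [hw]
        by_cases h1 : ∃ y ∈ T, π y = some i
        · rw [if_pos h1]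
          split_ifs <;> omega
        · have hxT : x ∉ T := fun h => h1 ⟨x, h, hπ⟩
          rw [if_neg h1, if_neg hxT]
          split_ifs with h2 h3
          · omega
          · obtain ⟨y, hy, k, hyk, hki⟩ := h2
            exact absurd (hN y hy x ((blowup_adj_iff G hyk hπ).2 hki)) h3
          · omega
          · omega
    have := Finset.sum_le_sum fun x (_ : x ∈ Finset.univ) => hpt x
    rw [Finset.sum_add_distrib, Finset.sum_add_distrib, ← Finset.card_filter,
      ← Finset.card_filter] at this
    simp only [Finset.sum_const, Finset.card_univ, smul_eq_mul, mul_one] at this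
    rw [Set.ncard_eq_toFinset_card', Set.ncard_eq_toFinset_card', ← Set.filter_mem_univ_eq_toFinset,
      ← Set.filter_mem_univ_eq_toFinset]
    omega

theorem exists_isInducedOddCycle_of_blowup {V α : Type*} (G : SimpleGraph V) (π : α → Option V)
    (A : Set α) (hA : ∀ x ∈ A, π x ≠ none) (hcol : ¬ ((blowup G π).induce A).Colorable 2) :
    ∃ m c, IsInducedOddCycle G m c ∧ ∀ p, ∃ x ∈ A, π x = some (c p) := by
  let s : Set V := {i | ∃ x ∈ A, π x = some i}
  refine exists_isInducedOddCycle_mem G s fun hs => hcol ?_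
  have h : ∀ x : A, ∃ i, π x = some i := fun x => Option.ne_none_iff_exists'.1 (hA x x.2)
  choose ρ hρ using h
  let f : (blowup G π).induce A →g G.induce s :=
    { toFun := fun x => ⟨ρ x, x, x.2, hρ x⟩
      map_rel' := fun {x y} hxy => (blowup_adj_iff G (hρ x) (hρ y)).1 hxy }
  exact hs.of_hom f

theorem blowup_separation {V α : Type*} (G : SimpleGraph V) (hG : OddCycleCondition G)
    (π : α → Option V) (A B : Set α) (hAB : Disjoint A B)
    (hadj : ∀ x ∈ A, ∀ y ∈ B, ¬ (blowup G π).Adj x y) :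
    ((blowup G π).induce A).Colorable 2 ∨ ((blowup G π).induce B).Colorable 2 := by
  by_contra hcon
  push Not at hcon
  obtain ⟨hA, hB⟩ := hcon
  have hne : ∀ C : Set α, ¬ ((blowup G π).induce C).Colorable 2 → C.Nonempty := by
    intro C hC
    by_contra h
    rw [Set.not_nonempty_iff_eq_empty] at h
    subst h
    exact hC (SimpleGraph.Colorable.of_isEmpty 2)
  have hxy : ∀ x ∈ A, ∀ y ∈ B, x ≠ y := fun x hx y hy h =>
    Set.disjoint_left.1 hAB hx (h ▸ hy)
  have hA0 : ∀ x ∈ A, π x ≠ none := by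
    intro x hx h
    obtain ⟨y, hy⟩ := hne B hB
    exact hadj x hx y hy (blowup_adj_of_eq_none G (hxy x hx y hy) h)
  have hB0 : ∀ y ∈ B, π y ≠ none := by
    intro y hy h
    obtain ⟨x, hx⟩ := hne A hA
    exact hadj x hx y hy (blowup_adj_of_eq_none G (hxy x hx y hy).symm h).symm
  obtain ⟨m₁, c₁, hc₁, h₁⟩ := exists_isInducedOddCycle_of_blowup G π A hA0 hA
  obtain ⟨m₂, c₂, hc₂, h₂⟩ := exists_isInducedOddCycle_of_blowup G π B hB0 hB
  have key : ∀ p q, ¬ G.Adj (c₁ p) (c₂ q) := by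
    intro p q h
    obtain ⟨x, hx, hxp⟩ := h₁ p
    obtain ⟨y, hy, hyq⟩ := h₂ q
    exact hadj x hx y hy ((blowup_adj_iff G hxp hyq).2 h)
  rcases hG _ _ _ _ hc₁ hc₂ with ⟨p, q, h⟩ | ⟨p, q, h⟩
  · apply key (p + 1) q
    rw [← h]
    exact (hc₁.2.2.2 _ _).2 (Or.inr rfl)
  · exact key p q h

/-- Under the odd cycle condition, a blow-up of the looped cone over `G` satisfying the
inequalities of the fractional stable set polytope has a perfect matching. -/
theorem exists_isPerfectMatching_blowup {V α : Type*} [Fintype α] (G : SimpleGraph V)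
    (hG : OddCycleCondition G) (π : α → Option V) (heven : Even (Fintype.card α))
    (hcone : ∀ w : Option V → ℕ, w none = 0 → (∀ i, w (some i) ≤ 2) →
      (∀ i j, G.Adj i j → w (some i) + w (some j) ≤ 2) → ∑ x, w (π x) ≤ Fintype.card α) :
    ∃ M : (blowup G π).Subgraph, M.IsPerfectMatching :=
  exists_isPerfectMatching_of_expansion _ heven (blowup_expansion G π heven hcone)
    (blowup_separation G hG π)

/-- The variable attached to a vertex of the cone, with the apex set to `1`. -/
def coneVar (o : Option V) : Amb K V := o.elim 1 fun i => X (some i)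

omit [DecidableEq V] in
theorem tGen_mem_RG : tGen K ∈ RG K G :=
  Algebra.subset_adjoin (Or.inl (Or.inl rfl))

omit [DecidableEq V] in
theorem vGen_mem_RG (i : V) : vGen K i ∈ RG K G :=
  Algebra.subset_adjoin (Or.inl (Or.inr ⟨i, rfl⟩))

omit [DecidableEq V] in
theorem eGen_mem_RG {i j : V} (h : G.Adj i j) : eGen K i j ∈ RG K G :=
  Algebra.subset_adjoin (Or.inr ⟨i, j, h, rfl⟩)

omit [DecidableEq V] in
theorem coneVar_mul_mem_RG : ∀ {o o' : Option V}, coneAdj G o o' →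
    coneVar K o * coneVar K o' * X none ∈ RG K G
  | some _, some _, h => eGen_mem_RG K G h
  | some i, none, _ => by simpa [coneVar, vGen] using vGen_mem_RG K G i
  | none, some i, _ => by simpa [coneVar, vGen] using vGen_mem_RG K G i
  | none, none, _ => by simpa [coneVar, tGen] using tGen_mem_RG K G

omit [DecidableEq V] in
theorem prod_coneVar_mem_RG_of_involution {α : Type*} [DecidableEq α] (π : α → Option V)
    (σ : α → α) (hσ : ∀ x, σ (σ x) = x) (hne : ∀ x, σ x ≠ x)
    (hadj : ∀ x, coneAdj G (π x) (π (σ x))) (k : ℕ) :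
    ∀ F : Finset α, (∀ x ∈ F, σ x ∈ F) → F.card = 2 * k →
      (∏ x ∈ F, coneVar K (π x)) * X none ^ k ∈ RG K G := by
  induction k with
  | zero =>
    intro F _ hF
    obtain rfl : F = ∅ := by simpa using hF
    simp
  | succ k ih =>
    intro F hF hcard
    obtain ⟨x, hx⟩ : F.Nonempty := Finset.card_pos.1 (by omega)
    have h1 : σ x ∈ F.erase x := Finset.mem_erase.2 ⟨hne x, hF x hx⟩
    have hmem := ih ((F.erase x).erase (σ x)) ?_ ?_
    · have hprod := (RG K G).mul_mem (coneVar_mul_mem_RG K G (hadj x)) hmem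
      rw [← Finset.mul_prod_erase F _ hx, ← Finset.mul_prod_erase _ _ h1, pow_succ]
      convert hprod using 1
      ring
    · intro y hy
      simp only [Finset.mem_erase] at hy ⊢
      refine ⟨fun h => hy.2.1 ?_, fun h => hy.1 ?_, hF y hy.2.2⟩
      · rw [← hσ y, h, hσ]
      · rw [← hσ y, h]
    · rw [Finset.card_erase_of_mem h1, Finset.card_erase_of_mem hx]
      omega

omit [DecidableEq V] in
theorem prod_coneVar_mem_RG {α : Type*} [Fintype α] (π : α → Option V) {k : ℕ}
    (hcard : Fintype.card α = 2 * k) {M : (blowup G π).Subgraph} (hM : M.IsPerfectMatching) :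
    (∏ x, coneVar K (π x)) * X none ^ k ∈ RG K G := by
  classical
  rw [SimpleGraph.Subgraph.isPerfectMatching_iff] at hM
  choose σ hσ huniq using hM
  exact prod_coneVar_mem_RG_of_involution K G π σ (fun x => (huniq _ _ (hσ x).symm).symm)
    (fun x => (M.adj_sub (hσ x)).ne') (fun x => (M.adj_sub (hσ x)).2) k Finset.univ
    (fun _ _ => Finset.mem_univ _) hcard

omit [DecidableEq V] in
/-- Under the odd cycle condition, a monomial whose exponent satisfies the inequalities of
the fractional stable set polytope belongs to the toric ring. -/
theorem monomial_mem_RG [Fintype V] (hG : OddCycleCondition G) (d : Option V →₀ ℕ)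
    (hd : ∀ w : V → ℕ, (∀ i, w i ≤ 2) → (∀ i j, G.Adj i j → w i + w j ≤ 2) →
      ∑ i, w i * d (some i) ≤ 2 * d none) (c : K) :
    monomial d c ∈ RG K G := by
  obtain ⟨m, hm0, hm1⟩ : ∃ m : Option V → ℕ,
      m none = 2 * d none - ∑ i, d (some i) ∧ ∀ i, m (some i) = d (some i) :=
    ⟨fun o => o.elim (2 * d none - ∑ i, d (some i)) fun i => d (some i), rfl, fun _ => rfl⟩
  let π : (Σ o : Option V, Fin (m o)) → Option V := Sigma.fst
  have h1 : ∑ i, d (some i) ≤ 2 * d none := by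
    simpa using hd (fun _ => 1) (by simp) (by simp)
  have hcard : Fintype.card (Σ o : Option V, Fin (m o)) = 2 * d none := by
    simp only [Fintype.card_sigma, Fintype.card_fin, Fintype.sum_option, hm0, hm1]
    omega
  obtain ⟨M, hM⟩ := exists_isPerfectMatching_blowup G hG π (by rw [hcard]; exact even_two_mul _) (by
    intro w h0 hw2 hw
    rw [hcard, Fintype.sum_sigma, Fintype.sum_option]
    simpa [π, hm1, h0, mul_comm] using hd (fun i => w (some i)) hw2 hw)
  have hmem := prod_coneVar_mem_RG K G π hcard hM
  have heq : monomial d c = c • ((∏ x, coneVar K (π x)) * X none ^ d none) := by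
    rw [Fintype.prod_sigma, Fintype.prod_option, MvPolynomial.monomial_eq,
      Finsupp.prod_fintype _ _ (by simp), Fintype.prod_option, MvPolynomial.smul_eq_C_mul]
    simp [π, hm1, coneVar, mul_comm]
  rw [heq]
  exact (RG K G).smul_mem hmem c

/-- The grading homomorphism `x^d ↦ x^d s^(ℓ d)` into Hahn series, where `ℓ` is the linear
form with coefficients `w`. -/
def gradingHom {σ : Type*} (w : σ → ℤ) :
    MvPolynomial σ K →+* HahnSeries ℤ (MvPolynomial σ K) :=
  eval₂Hom (HahnSeries.C.comp C) fun o => HahnSeries.single (w o) (X o)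

theorem gradingHom_monomial {σ : Type*} (w : σ → ℤ) (d : σ →₀ ℕ) (c : K) :
    gradingHom K w (monomial d c) = HahnSeries.single (Finsupp.weight w d) (monomial d c) := by
  have hX : ∀ (o : σ) (k : ℕ), HahnSeries.single (w o) (X o : MvPolynomial σ K) ^ k =
      HahnSeries.single (k • w o) (X o ^ k) := fun o k => HahnSeries.single_pow _ _ _
  have hprod : ∀ s : Finset σ, ∏ o ∈ s, HahnSeries.single (w o) (X o : MvPolynomial σ K) ^ d o =
      HahnSeries.single (∑ o ∈ s, d o • w o) (∏ o ∈ s, X o ^ d o) := by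
    classical
    intro s
    induction s using Finset.induction_on with
    | empty => rfl
    | insert o s ho ih =>
      rw [Finset.prod_insert ho, Finset.prod_insert ho, Finset.sum_insert ho, ih, hX,
        HahnSeries.single_mul_single]
  rw [gradingHom, eval₂Hom_monomial, Finsupp.prod, hprod, RingHom.comp_apply, HahnSeries.C_apply,
    HahnSeries.single_mul_single, zero_add, monomial_eq, Finsupp.weight_apply]
  rfl

theorem coeff_gradingHom {σ : Type*} (w : σ → ℤ) (f : MvPolynomial σ K) (d : σ →₀ ℕ) :
    ((gradingHom K w f).coeff (Finsupp.weight w d)).coeff d = f.coeff d := by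
  classical
  induction f using MvPolynomial.induction_on' with
  | monomial e c =>
    rw [gradingHom_monomial, HahnSeries.coeff_single, coeff_monomial]
    split_ifs with h1 h2 h2
    · simp [coeff_monomial, h2]
    · simp [coeff_monomial, h2]
    · exact absurd (by rw [h2]) h1
    · simp
  | add p q hp hq => simp [hp, hq]

/-- The valuation of a polynomial given by the least value of a linear form on its support. -/
def weightVal {σ : Type*} (w : σ → ℤ) : AddValuation (MvPolynomial σ K) (WithTop ℤ) :=
  (HahnSeries.addVal ℤ (MvPolynomial σ K)).comap (gradingHom K w)

theorem weightVal_X {σ : Type*} (w : σ → ℤ) (o : σ) : weightVal K w (X o) = w o := by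
  change HahnSeries.addVal ℤ _ (gradingHom K w (X o)) = _
  rw [gradingHom, eval₂Hom_X', HahnSeries.addVal_apply, HahnSeries.orderTop_single (X_ne_zero o)]

theorem weightVal_le {σ : Type*} (w : σ → ℤ) (f : MvPolynomial σ K) {d : σ →₀ ℕ}
    (hd : d ∈ f.support) : weightVal K w f ≤ Finsupp.weight w d := by
  apply HahnSeries.addVal_le_of_coeff_ne_zero
  intro h
  rw [mem_support_iff, ← coeff_gradingHom K w f d] at hd
  exact hd (by
    change (gradingHom K w f).coeff _ = 0 at h
    rw [h, coeff_zero])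

theorem weightVal_algebraMap_nonneg {σ : Type*} (w : σ → ℤ) (c : K) :
    0 ≤ weightVal K w (algebraMap K _ c) := by
  change 0 ≤ HahnSeries.addVal ℤ _ (gradingHom K w (C c))
  rw [gradingHom, eval₂Hom_C, RingHom.comp_apply, HahnSeries.C_apply, HahnSeries.addVal_apply]
  exact HahnSeries.orderTop_single_le

/-- An additive valuation that is nonnegative on a subring is nonnegative on its integral
closure. -/
theorem AddValuation.nonneg_of_isIntegral {R : Type*} [CommRing R] (v : AddValuation R (WithTop ℤ))
    {A : Type*} [CommRing A] [Algebra A R] (hA : ∀ a : A, 0 ≤ v (algebraMap A R a)) {f : R}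
    (hf : IsIntegral A f) : 0 ≤ v f := by
  let v' := AddValuation.toValuation v
  let g : A →+* v'.integer := (algebraMap A R).codRestrict _ fun a => hA a
  have hint : IsIntegral v'.integer f := by
    obtain ⟨p, hp, hpf⟩ := hf
    refine ⟨p.map g, hp.map g, ?_⟩
    rw [Polynomial.eval₂_map]
    exact hpf
  exact (Valuation.integer.integers v').mem_of_integral hint

omit [DecidableEq V] in
theorem weightVal_nonneg_of_mem_RG (w : Option V → ℤ) (h0 : 0 ≤ w none)
    (h1 : ∀ i, 0 ≤ w (some i) + w none)
    (h2 : ∀ i j, G.Adj i j → 0 ≤ w (some i) + w (some j) + w none) {f : Amb K V}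
    (hf : f ∈ RG K G) : 0 ≤ weightVal K w f := by
  induction hf using Algebra.adjoin_induction with
  | mem x hx =>
    rcases hx with (rfl | ⟨i, rfl⟩) | ⟨i, j, hij, rfl⟩
    · rw [tGen, weightVal_X]
      exact_mod_cast h0
    · rw [vGen, AddValuation.map_mul, weightVal_X, weightVal_X]
      exact_mod_cast h1 i
    · rw [eGen, AddValuation.map_mul, AddValuation.map_mul, weightVal_X, weightVal_X, weightVal_X]
      exact_mod_cast h2 i j hij
  | algebraMap c => exact weightVal_algebraMap_nonneg K w c
  | add x y _ _ hx hy => exact (le_min hx hy).trans (AddValuation.map_add _ _ _)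
  | mul x y _ _ hx hy =>
    rw [AddValuation.map_mul]
    exact add_nonneg hx hy

omit [DecidableEq V] in
theorem mem_RG_of_isIntegral [Fintype V] (hG : OddCycleCondition G) {f : Amb K V}
    (hf : IsIntegral (RG K G) f) : f ∈ RG K G := by
  rw [f.as_sum]
  refine (RG K G).sum_mem fun d hd => monomial_mem_RG K G hG d (fun w hw2 hw => ?_) _
  let w' : Option V → ℤ := fun o => o.elim 2 fun i => -(w i : ℤ)
  have h1 := AddValuation.nonneg_of_isIntegral (weightVal K w')
    (fun a => weightVal_nonneg_of_mem_RG K G w' (by simp [w']) (by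
      intro i
      have := hw2 i
      simp only [w', Option.elim]
      omega) (by
      intro i j hij
      have := hw i j hij
      simp only [w', Option.elim]
      omega) a.2) hf
  have h2 := h1.trans (weightVal_le K w' f hd)
  norm_cast at h2
  rw [Finsupp.weight_eq_sum, Fintype.sum_option] at h2
  simp only [w', Option.elim, nsmul_eq_mul, mul_neg, Finset.sum_neg_distrib] at h2
  zify
  simp only [mul_comm (w _ : ℤ)]
  linarith

/-- A subalgebra of an integrally closed domain that contains all elements integral over it
is integrally closed. -/
theorem isIntegrallyClosed_of_isIntegral_mem {k A : Type*} [Field k] [CommRing A] [IsDomain A]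
    [IsIntegrallyClosed A] [Algebra k A] (R : Subalgebra k A)
    (hR : ∀ f : A, IsIntegral R f → f ∈ R) : IsIntegrallyClosed R := by
  rw [isIntegrallyClosed_iff (FractionRing R)]
  intro x hx
  have hinj : Function.Injective R.val.toRingHom := Subtype.val_injective
  let φ : FractionRing R →+* FractionRing A := IsFractionRing.map (A := R) (B := A) hinj
  have hφ : ∀ r : R, φ (algebraMap R _ r) = algebraMap A _ (r : A) := fun r =>
    IsLocalization.map_eq _ r
  have hx' : IsIntegral R (φ x) := by
    obtain ⟨p, hp, hpx⟩ := hx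
    refine ⟨p, hp, ?_⟩
    have hcomp : algebraMap R (FractionRing A) = φ.comp (algebraMap R (FractionRing R)) :=
      RingHom.ext fun r => (hφ r).symm
    rw [hcomp, ← Polynomial.hom_eval₂, hpx, map_zero]
  obtain ⟨f, hf⟩ := (isIntegrallyClosed_iff (FractionRing A)).1 ‹_› (hx'.tower_top (A := A))
  rw [← hf] at hx'
  have hfR : f ∈ R := hR f ((isIntegral_algebraMap_iff (IsFractionRing.injective A _)).1 hx')
  exact ⟨⟨f, hfR⟩, φ.injective (by rw [hφ, hf])⟩

omit [DecidableEq V] in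
/-- The toric ring of a graph satisfying the odd cycle condition is integrally closed. -/
theorem isIntegrallyClosed_RG [Fintype V] (hG : OddCycleCondition G) :
    IsIntegrallyClosed (RG K G) :=
  isIntegrallyClosed_of_isIntegral_mem (RG K G) fun _ hf => mem_RG_of_isIntegral K G hG hf

/-- If all generators of the toric ring have exponents in a submonoid, then so do all
monomials of its elements. -/
theorem support_subset_of_mem_RG (P : AddSubmonoid (Option V →₀ ℕ))
    (h0 : Finsupp.single none 1 ∈ P)
    (h1 : ∀ i, Finsupp.single (some i) 1 + Finsupp.single none 1 ∈ P)
    (h2 : ∀ i j, G.Adj i j →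
      Finsupp.single (some i) 1 + Finsupp.single (some j) 1 + Finsupp.single none 1 ∈ P)
    {f : Amb K V} (hf : f ∈ RG K G) : ∀ d ∈ f.support, d ∈ P := by
  have hmon : ∀ e ∈ P, ∀ c : K, ∀ d ∈ (monomial e c).support, d ∈ P := by
    intro e he c d hd
    rwa [Finset.mem_singleton.1 (support_monomial_subset hd)]
  induction hf using Algebra.adjoin_induction with
  | mem x hx =>
    rcases hx with (rfl | ⟨i, rfl⟩) | ⟨i, j, hij, rfl⟩
    · exact hmon _ h0 1
    · rw [vGen, X, X, monomial_mul]
      exact hmon _ (h1 i) _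
    · rw [eGen, X, X, X, monomial_mul, monomial_mul]
      exact hmon _ (h2 i j hij) _
  | algebraMap c => exact hmon 0 P.zero_mem c
  | add x y _ _ hx hy =>
    intro d hd
    rcases Finset.mem_union.1 (support_add hd) with h | h
    · exact hx d h
    · exact hy d h
  | mul x y _ _ hx hy =>
    intro d hd
    obtain ⟨a, ha, b, hb, rfl⟩ := Finset.mem_add.1 (support_mul x y hd)
    exact P.add_mem (hx a ha) (hy b hb)

/-- The product of the variables along a cyclic enumeration of vertices. -/
def cycleProd (m : ℕ) [NeZero m] (c : ZMod m → V) : Amb K V := ∏ p, X (some (c p))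

omit [DecidableEq V] in
theorem cycleProd_sq_mem_RG {m : ℕ} [NeZero m] {c : ZMod m → V} (hc : IsInducedOddCycle G m c) :
    cycleProd K m c ^ 2 * X none ^ m ∈ RG K G := by
  have hshift : ∏ p, (X (some (c (p + 1))) : Amb K V) = cycleProd K m c :=
    Fintype.prod_equiv (Equiv.addRight 1) _ _ fun _ => rfl
  have hprod : cycleProd K m c ^ 2 * X none ^ m = ∏ p, eGen K (c p) (c (p + 1)) := by
    simp only [eGen]
    rw [Finset.prod_mul_distrib, Finset.prod_mul_distrib, hshift, Finset.prod_const,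
      Finset.card_univ, ZMod.card, pow_two]
    rfl
  rw [hprod]
  exact (RG K G).prod_mem fun p _ => eGen_mem_RG K G ((hc.2.2.2 _ _).2 (Or.inl rfl))

omit [DecidableEq V] in
theorem cycleProd_mul_mem_RG (m : ℕ) [NeZero m] (c : ZMod m → V) :
    cycleProd K m c * X none ^ m ∈ RG K G := by
  have hprod : cycleProd K m c * X none ^ m = ∏ p, vGen K (c p) := by
    simp only [vGen]
    rw [Finset.prod_mul_distrib, Finset.prod_const, Finset.card_univ, ZMod.card]
    rfl
  rw [hprod]
  exact (RG K G).prod_mem fun p _ => vGen_mem_RG K G _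

/-- For two disjoint cycles of odd length not joined by an edge, the product of all their
variables with the matching power of `t` is not in the toric ring. -/
theorem cycleProd_mul_cycleProd_notMem_RG {m₁ m₂ : ℕ} [NeZero m₁] [NeZero m₂] {c₁ : ZMod m₁ → V}
    {c₂ : ZMod m₂ → V} (ho : Odd m₁) (hne : ∀ p q, c₁ p ≠ c₂ q)
    (hadj : ∀ p q, ¬ G.Adj (c₁ p) (c₂ q)) {b : ℕ} (hb : m₁ + m₂ = 2 * b) :
    cycleProd K m₁ c₁ * cycleProd K m₂ c₂ * X none ^ b ∉ RG K G := by
  classical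
  intro hmem
  let h : Option V → ℤ := fun o => o.elim 2 fun _ => -1
  let u : Option V → ℕ := fun o => o.elim 0 fun i => if i ∈ Set.range c₁ ∪ Set.range c₂ then 0 else 1
  let w : Option V → ℕ := fun o => o.elim 0 fun i => if i ∈ Set.range c₁ then 1 else 0
  let P : AddSubmonoid (Option V →₀ ℕ) :=
    { carrier := {d | 0 ≤ Finsupp.weight h d ∧
        (Finsupp.weight h d = 0 → Finsupp.weight u d = 0 → Even (Finsupp.weight w d))}
      zero_mem' := by simp
      add_mem' := by
        rintro d e ⟨hd1, hd2⟩ ⟨he1, he2⟩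
        simp only [Set.mem_ofPred_eq, map_add]
        refine ⟨add_nonneg hd1 he1, fun h1 h2 => ?_⟩
        exact (hd2 (by omega) (by omega)).add (he2 (by omega) (by omega)) }
  have hP : ∀ d, d ∈ P ↔ 0 ≤ Finsupp.weight h d ∧
      (Finsupp.weight h d = 0 → Finsupp.weight u d = 0 → Even (Finsupp.weight w d)) := fun _ => Iff.rfl
  let D : Option V →₀ ℕ := (∑ p, Finsupp.single (some (c₁ p)) 1) +
    (∑ q, Finsupp.single (some (c₂ q)) 1) + Finsupp.single none b
  have hD : cycleProd K m₁ c₁ * cycleProd K m₂ c₂ * X none ^ b = monomial D 1 := by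
    have hX : ∀ (m : ℕ) [NeZero m] (c : ZMod m → V),
        cycleProd K m c = monomial (∑ p, Finsupp.single (some (c p)) 1) 1 := by
      intro m _ c
      rw [monomial_sum_one]
      rfl
    rw [hX, hX, X_pow_eq_monomial, monomial_mul, monomial_mul, one_mul, one_mul]
  rw [hD] at hmem
  have hDP := support_subset_of_mem_RG K G P ?_ ?_ ?_ hmem D (by
    rw [mem_support_iff, coeff_monomial, if_pos rfl]
    exact one_ne_zero)
  · rw [hP] at hDP
    have hh : Finsupp.weight h D = 0 := by
      simp only [D, map_add, map_sum, Finsupp.weight_single, h, Option.elim, Finset.sum_const,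
        Finset.card_univ, ZMod.card]
      simp only [nsmul_eq_mul]
      push_cast
      have : (m₁ : ℤ) + m₂ = 2 * b := by exact_mod_cast hb
      linarith
    have hu : Finsupp.weight u D = 0 := by
      simp [D, Finsupp.weight_single, u]
    have hw : Finsupp.weight w D = m₁ := by
      have h2 : ∀ q, ¬ ∃ p, c₁ p = c₂ q := fun q ⟨p, hp⟩ => hne p q hp
      simp [D, Finsupp.weight_single, w, h2]
    have := hDP.2 hh hu
    rw [hw, ← Nat.not_odd_iff_even] at this
    exact this ho
  · rw [hP]
    simp [Finsupp.weight_single, h]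
  · intro i
    rw [hP]
    simp [Finsupp.weight_single, h]
  · intro i j hij
    rw [hP]
    refine ⟨by simp [Finsupp.weight_single, h], fun _ hu => ?_⟩
    simp only [map_add, Finsupp.weight_single, u, Option.elim, one_smul, add_zero] at hu
    have hi : i ∈ Set.range c₁ ∪ Set.range c₂ := by
      by_contra hi
      rw [if_neg hi] at hu
      omega
    have hj : j ∈ Set.range c₁ ∪ Set.range c₂ := by
      by_contra hj
      rw [if_neg hj] at hu
      omega
    simp only [map_add, Finsupp.weight_single, w, Option.elim, one_smul, add_zero]
    by_cases hi1 : i ∈ Set.range c₁ <;> by_cases hj1 : j ∈ Set.range c₁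
    · simp only [hi1, hj1, if_true]
      decide
    · obtain ⟨p, rfl⟩ := hi1
      obtain ⟨q, rfl⟩ := hj.resolve_left hj1
      exact absurd hij (hadj p q)
    · obtain ⟨p, rfl⟩ := hj1
      obtain ⟨q, rfl⟩ := hi.resolve_left hi1
      exact absurd hij.symm (hadj p q)
    · simp only [hi1, hj1, if_false]
      decide

/-- If the toric ring is integrally closed, the graph satisfies the odd cycle condition. -/
theorem oddCycleCondition_of_isIntegrallyClosed (h : IsIntegrallyClosed (RG K G)) :
    OddCycleCondition G := by
  intro m₁ c₁ m₂ c₂ h₁ h₂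
  by_contra hcon
  push Not at hcon
  obtain ⟨hne, hadj⟩ := hcon
  have : NeZero m₁ := ⟨by have := h₁.1; omega⟩
  have : NeZero m₂ := ⟨by have := h₂.1; omega⟩
  obtain ⟨b, hb⟩ : ∃ b, m₁ + m₂ = 2 * b := (h₁.2.1.add_odd h₂.2.1).exists_two_nsmul _
  let f : Amb K V := cycleProd K m₁ c₁ * cycleProd K m₂ c₂ * X none ^ b
  have hf : f ∉ RG K G := cycleProd_mul_cycleProd_notMem_RG K G h₁.2.1 hne hadj hb
  have hf2 : f ^ 2 ∈ RG K G := by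
    convert (RG K G).mul_mem (cycleProd_sq_mem_RG K G h₁) (cycleProd_sq_mem_RG K G h₂) using 1
    calc f ^ 2 = cycleProd K m₁ c₁ ^ 2 * cycleProd K m₂ c₂ ^ 2 * X none ^ (2 * b) := by
          simp only [f]; ring
      _ = _ := by rw [← hb]; ring
  have ht : (X none : Amb K V) ∈ RG K G := tGen_mem_RG K G
  have hden : (X none : Amb K V) ^ (2 * b) ∈ RG K G := (RG K G).pow_mem ht _
  have hnum : f * X none ^ (2 * b) ∈ RG K G := by
    convert (RG K G).mul_mem ((RG K G).mul_mem (cycleProd_mul_mem_RG K G m₁ c₁)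
      (cycleProd_mul_mem_RG K G m₂ c₂)) ((RG K G).pow_mem ht b) using 1
    rw [← hb]
    simp only [f]
    ring
  have hdvd : (⟨_, hden⟩ : RG K G) ^ 2 ∣ ⟨_, hnum⟩ ^ 2 :=
    ⟨⟨_, hf2⟩, Subtype.ext (by
      change (f * X none ^ (2 * b)) ^ 2 = (X none ^ (2 * b)) ^ 2 * f ^ 2
      ring)⟩
  obtain ⟨⟨r, hr⟩, hrf⟩ := (IsIntegrallyClosed.pow_dvd_pow_iff two_ne_zero).1 hdvd
  have hrf' : f * X none ^ (2 * b) = X none ^ (2 * b) * r := congrArg Subtype.val hrf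
  rw [mul_comm] at hrf'
  exact hf (mul_left_cancel₀ (pow_ne_zero _ (X_ne_zero _)) hrf' ▸ hr)

theorem IsInducedOddCycle.reachable {α : Type*} {H : SimpleGraph α} {m : ℕ} {c : ZMod m → α}
    (hc : IsInducedOddCycle H m c) (p q : ZMod m) : H.Reachable (c p) (c q) := by
  have : NeZero m := ⟨by have := hc.1; omega⟩
  have key : ∀ k : ℕ, H.Reachable (c p) (c (p + k)) := by
    intro k
    induction k with
    | zero => simp
    | succ k ih =>
      refine ih.trans (SimpleGraph.Adj.reachable ((hc.2.2.2 _ _).2 (Or.inl ?_)))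
      push_cast
      ring
  have := key (q - p).val
  rwa [ZMod.natCast_zmod_val, add_sub_cancel] at this

theorem OddCycleCondition.reachable {α : Type*} {H : SimpleGraph α} (h : OddCycleCondition H)
    {m₁ m₂ : ℕ} {c₁ : ZMod m₁ → α} {c₂ : ZMod m₂ → α} (h₁ : IsInducedOddCycle H m₁ c₁)
    (h₂ : IsInducedOddCycle H m₂ c₂) (p : ZMod m₁) (q : ZMod m₂) :
    H.Reachable (c₁ p) (c₂ q) := by
  rcases h _ _ _ _ h₁ h₂ with ⟨p', q', he⟩ | ⟨p', q', ha⟩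
  · have := h₁.reachable p p'
    rw [he] at this
    exact this.trans (h₂.reachable q' q)
  · exact ((h₁.reachable p p').trans ha.reachable).trans (h₂.reachable q' q)

/-- The toric ring `R_G` is a normal domain if and only if at most one
connected component of `G` is non-bipartite (equivalently: all induced odd cycles of
`G` lie in one connected component) and this component satisfies the odd cycle
condition (any two induced odd cycles share a vertex or are joined by an edge). -/
theorem stmt3 (K : Type*) [Field K] {n : ℕ} (G : SimpleGraph (Fin n)) :
    (IsDomain ↥(RG K G) ∧ IsIntegrallyClosed ↥(RG K G)) ↔
      ((∀ (m₁ : ℕ) (c₁ : ZMod m₁ → Fin n) (m₂ : ℕ) (c₂ : ZMod m₂ → Fin n),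
          IsInducedOddCycle G m₁ c₁ → IsInducedOddCycle G m₂ c₂ →
            ∀ p q, G.Reachable (c₁ p) (c₂ q)) ∧
        (∀ (m₁ : ℕ) (c₁ : ZMod m₁ → Fin n) (m₂ : ℕ) (c₂ : ZMod m₂ → Fin n),
          IsInducedOddCycle G m₁ c₁ → IsInducedOddCycle G m₂ c₂ →
            (∃ p q, c₁ p = c₂ q) ∨ ∃ p q, G.Adj (c₁ p) (c₂ q))) := by
  constructor
  · rintro ⟨-, h⟩
    have hG := oddCycleCondition_of_isIntegrallyClosed K G h
    exact ⟨fun _ _ _ _ h₁ h₂ => hG.reachable h₁ h₂, hG⟩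
  · rintro ⟨-, hG⟩
    exact ⟨inferInstance, isIntegrallyClosed_RG K G hG⟩
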